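/- arXiv:2311.10900 — 2 statements merged into one kernel-verified Lean document; each statement's English description precedes it below -/
import Mathlib

section
/- Let m ≥ 1, α ∈ (0,1), and let D : [0,1] → ℝ be monotone nondecreasing with D(q) ≥ q^m for all q ∈ [0,1] (positive lower orthant dependency of the diagonal). Let q_max denote the infimum of {q ∈ [0,1] : D(q) ≥ 1 − α}. Then q_max ≤ (1 − α)^{1/m} ≤ 1 − α/m. In words, the max-rank solution under positive lower orthant dependency is at most the optimal solution under independence, which is at most the Bonferroni quantile probability; hence max-rank provides statistical power at least as high as the Bonferroni correction while retaining Type-I error control. -/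
/-- **Max-rank is at least as powerful as Bonferroni.**
Let `D : [0,1] → ℝ` be monotone nondecreasing with `D q ≥ q^m` (positive lower orthant
dependency on the diagonal), and let `q_max` be the infimum of `{q ∈ [0,1] : D q ≥ 1 - α}`.
Then `q_max ≤ (1 - α)^(1/m) ≤ 1 - α/m`: the max-rank solution under PLOD is at most the
optimal independence solution, which is at most the Bonferroni quantile probability. -/
theorem maxrank_le_indep_le_bonferroni
    (m : ℕ) (hm : 1 ≤ m) (α : ℝ) (hα : α ∈ Set.Ioo (0 : ℝ) 1)
    (D : ℝ → ℝ) (hmono : MonotoneOn D (Set.Icc 0 1))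
    (hplod : ∀ q ∈ Set.Icc (0 : ℝ) 1, D q ≥ q ^ m) :
    sInf {q : ℝ | q ∈ Set.Icc (0 : ℝ) 1 ∧ D q ≥ 1 - α} ≤ (1 - α) ^ ((1 : ℝ) / m) ∧
      (1 - α) ^ ((1 : ℝ) / m) ≤ 1 - α / m := by
  obtain ⟨hα0, hα1⟩ := hα
  have hm' : (1 : ℝ) ≤ m := by exact_mod_cast hm
  have h0 : (0 : ℝ) ≤ 1 - α := by linarith
  have hp0 : (0 : ℝ) ≤ 1 / m := by positivity
  have hp1 : (1 : ℝ) / m ≤ 1 := div_le_one_of_le₀ hm' (by linarith)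
  constructor
  · have hq : (1 - α) ^ ((1 : ℝ) / m) ∈ Set.Icc (0 : ℝ) 1 :=
      ⟨Real.rpow_nonneg h0 _, Real.rpow_le_one h0 (by linarith) hp0⟩
    refine csInf_le ⟨0, fun q hq => hq.1.1⟩ ⟨hq, ?_⟩
    have hpow : ((1 - α) ^ ((1 : ℝ) / m)) ^ m = 1 - α := by
      rw [one_div]
      exact Real.rpow_inv_natCast_pow h0 (by omega)
    exact hpow.ge.trans (hplod _ hq)
  · have h := rpow_one_add_le_one_add_mul_self (s := -α) (by linarith) hp0 hp1
    calc (1 - α) ^ ((1 : ℝ) / m) = (1 + -α) ^ ((1 : ℝ) / m) := by rw [sub_eq_add_neg]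
      _ ≤ 1 + 1 / m * -α := h
      _ = 1 - α / m := by ring
end

section
/- Let n ≥ 1 and α ∈ (0,1), and let S = (s_1,…,s_{n+1}) be an exchangeable random vector in ℝ^{n+1} whose coordinates are almost surely pairwise distinct. Let rank_{n+1} = |{j ∈ {1,…,n+1} : s_j ≤ s_{n+1}}| be the rank of the last coordinate. Then P(rank_{n+1} ≤ ⌈(n+1)(1−α)⌉) = ⌈(n+1)(1−α)⌉/(n+1) ≥ 1 − α. In particular, the split conformal prediction set built from the ⌈(n+1)(1−α)⌉-th smallest calibration score is marginally valid at level 1 − α. -/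
open MeasureTheory
open scoped ProbabilityTheory ENNReal

section Rank

variable {ι β : Type*} [Fintype ι] [LinearOrder β]

/-- The rank of `x i` in the finite family `x`. -/
def familyRank (x : ι → β) (i : ι) : ℕ :=
  (Finset.univ.filter fun j => x j ≤ x i).card

lemma familyRank_comp_perm (x : ι → β) (σ : Equiv.Perm ι) (i : ι) :
    familyRank (fun j => x (σ j)) i = familyRank x (σ i) := by
  unfold familyRank
  exact Finset.card_equiv σ (by simp)

lemma familyRank_strictMono {x : ι → β} {i j : ι} (h : x i < x j) :
    familyRank x i < familyRank x j := by
  refine Finset.card_lt_card (Finset.ssubset_iff_of_subset ?_ |>.2 ⟨j, by simp, by simpa using h⟩)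
  exact Finset.monotone_filter_right _ fun _ _ hl => hl.trans h.le

lemma familyRank_injective {x : ι → β} (hx : Function.Injective x) :
    Function.Injective (familyRank x) := by
  intro i j h
  by_contra hij
  rcases lt_or_gt_of_ne (hx.ne hij) with hlt | hlt
  · exact (familyRank_strictMono hlt).ne h
  · exact (familyRank_strictMono hlt).ne' h

lemma image_familyRank {x : ι → β} (hx : Function.Injective x) :
    Finset.univ.image (familyRank x) = Finset.Icc 1 (Fintype.card ι) := by
  refine Finset.eq_of_subset_of_card_le (fun r hr => ?_) ?_
  · obtain ⟨i, -, rfl⟩ := Finset.mem_image.1 hr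
    exact Finset.mem_Icc.2 ⟨Finset.card_pos.2 ⟨i, by simp⟩, Finset.card_le_univ _⟩
  · rw [Finset.card_image_of_injective _ (familyRank_injective hx)]
    simp

lemma card_familyRank_le {x : ι → β} (hx : Function.Injective x) {k : ℕ}
    (hk : k ≤ Fintype.card ι) :
    (Finset.univ.filter fun i => familyRank x i ≤ k).card = k := by
  rw [← Finset.card_image_of_injective _ (familyRank_injective hx),
    ← Finset.filter_image (p := fun r => r ≤ k), image_familyRank hx]
  have : (Finset.Icc 1 (Fintype.card ι)).filter (fun r => r ≤ k) = Finset.Icc 1 k := by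
    ext r
    simp only [Finset.mem_filter, Finset.mem_Icc]
    omega
  simp [this]

end Rank

lemma measurable_familyRank {ι : Type*} [Fintype ι] (i : ι) :
    Measurable fun x : ι → ℝ => familyRank x i := by
  simp only [familyRank, Finset.card_filter]
  exact Finset.measurable_fun_sum _ fun j _ => Measurable.ite
    (measurableSet_le (measurable_pi_apply j) (measurable_pi_apply i))
    measurable_const measurable_const

lemma measurableSet_familyRank_le {ι : Type*} [Fintype ι] (i : ι) (k : ℕ) :
    MeasurableSet {x : ι → ℝ | familyRank x i ≤ k} :=
  measurable_familyRank i measurableSet_Iic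

/-- Under an exchangeable law on `ι → ℝ` with almost surely distinct coordinates, each coordinate
has rank at most `k` with probability `k / |ι|`. -/
lemma measure_familyRank_le_of_exchangeable {ι : Type*} [Fintype ι]
    (μ : Measure (ι → ℝ)) [IsProbabilityMeasure μ]
    (hexch : ∀ σ : Equiv.Perm ι, μ.map (fun x i => x (σ i)) = μ)
    (hdist : ∀ᵐ x ∂μ, Function.Injective x) {k : ℕ} (hk : k ≤ Fintype.card ι) (i : ι) :
    μ {x | familyRank x i ≤ k} = (k : ℝ≥0∞) / Fintype.card ι := by
  classical
  have hA (j : ι) : MeasurableSet {x : ι → ℝ | familyRank x j ≤ k} :=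
    measurableSet_familyRank_le j k
  have heq (j : ι) : μ {x | familyRank x j ≤ k} = μ {x | familyRank x i ≤ k} := by
    conv_rhs => rw [← hexch (Equiv.swap i j)]
    rw [Measure.map_apply (by fun_prop) (hA i)]
    simp only [Set.preimage_ofPred_eq, familyRank_comp_perm, Equiv.swap_apply_left]
  have hsum : ∑ j, μ {x | familyRank x j ≤ k} = k := by
    calc ∑ j, μ {x | familyRank x j ≤ k}
        = ∑ j, ∫⁻ x, {x : ι → ℝ | familyRank x j ≤ k}.indicator 1 x ∂μ := by
          simp only [lintegral_indicator_one (hA _)]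
      _ = ∫⁻ x, ∑ j, {x : ι → ℝ | familyRank x j ≤ k}.indicator 1 x ∂μ :=
          (lintegral_finsetSum _ fun j _ => measurable_one.indicator (hA j)).symm
      _ = ∫⁻ _, (k : ℝ≥0∞) ∂μ := by
          refine lintegral_congr_ae ?_
          filter_upwards [hdist] with x hx
          simp only [Set.indicator_apply, Set.mem_ofPred_eq, Pi.one_apply, Finset.sum_boole,
            card_familyRank_le hx hk]
      _ = k := by simp
  simp only [heq, Finset.sum_const, Finset.card_univ, nsmul_eq_mul] at hsum
  have : Nonempty ι := ⟨i⟩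
  rw [ENNReal.eq_div_iff (by simp) (by simp), hsum]

/-- **Marginal validity of split conformal prediction.**
Let `s : Ω → Fin (n+1) → ℝ` be an exchangeable vector of `n` calibration scores together with a
test score (the last coordinate), with almost surely pairwise distinct coordinates, and let
`rank_{n+1} = |{j : s_j ≤ s_{n+1}}|`. Then
`P(rank_{n+1} ≤ ⌈(n+1)(1-α)⌉) = ⌈(n+1)(1-α)⌉ / (n+1) ≥ 1 - α`. -/
theorem split_conformal_marginal_validity
    {Ω : Type*} [MeasureSpace Ω] [IsProbabilityMeasure (ℙ : Measure Ω)]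
    (n : ℕ) (hn : 1 ≤ n) (α : ℝ) (hα : α ∈ Set.Ioo (0 : ℝ) 1)
    (s : Ω → Fin (n + 1) → ℝ)
    (hmeas : ∀ i, Measurable fun ω => s ω i)
    (hexch : ∀ σ : Equiv.Perm (Fin (n + 1)),
      Measure.map (fun ω => fun i => s ω (σ i)) ℙ = Measure.map s ℙ)
    (hdist : ∀ᵐ ω ∂ℙ, ∀ i j : Fin (n + 1), i ≠ j → s ω i ≠ s ω j) :
    ℙ {ω : Ω | (Finset.univ.filter fun j : Fin (n + 1) =>
          s ω j ≤ s ω (Fin.last n)).card ≤ ⌈((n : ℝ) + 1) * (1 - α)⌉₊} =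
        (⌈((n : ℝ) + 1) * (1 - α)⌉₊ : ℝ≥0∞) / ((n : ℝ≥0∞) + 1) ∧
      ENNReal.ofReal (1 - α) ≤ (⌈((n : ℝ) + 1) * (1 - α)⌉₊ : ℝ≥0∞) / ((n : ℝ≥0∞) + 1) := by
  have hs : Measurable s := measurable_pi_lambda s hmeas
  have : IsProbabilityMeasure (Measure.map s ℙ) := Measure.isProbabilityMeasure_map hs.aemeasurable
  have hk : ⌈((n : ℝ) + 1) * (1 - α)⌉₊ ≤ Fintype.card (Fin (n + 1)) := by
    rw [Fintype.card_fin, Nat.ceil_le]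
    push_cast
    exact mul_le_of_le_one_right (by positivity) (by linarith [hα.1])
  constructor
  · have hrank := measure_familyRank_le_of_exchangeable (Measure.map s ℙ)
      (fun σ => by
        rw [Measure.map_map (by fun_prop) hs]
        exact hexch σ)
      (by
        have hinj : MeasurableSet {x : Fin (n + 1) → ℝ | Function.Injective x} := by
          simp only [Function.Injective, Set.ofPred_forall]
          exact .iInter fun i => .iInter fun j => (measurableSet_eq_fun
            (measurable_pi_apply i) (measurable_pi_apply j)).imp (.const _)
        rw [ae_map_iff hs.aemeasurable hinj]
        filter_upwards [hdist] with ω hω i j hij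
        exact not_imp_not.1 (hω i j) hij)
      hk (Fin.last n)
    rw [Measure.map_apply hs (measurableSet_familyRank_le _ _)] at hrank
    simpa [familyRank] using hrank
  · rw [ENNReal.le_div_iff_mul_le (by simp) (by simp), ← ENNReal.ofReal_natCast n,
      ← ENNReal.ofReal_one, ← ENNReal.ofReal_add (by positivity) zero_le_one,
      ← ENNReal.ofReal_mul (by linarith [hα.2]), ← ENNReal.ofReal_natCast, mul_comm]
    exact ENNReal.ofReal_le_ofReal (Nat.le_ceil _)
end
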